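/- Let G be a transitive subgroup of S_n acting on {1,...,n}. Suppose G contains a subgroup H that, as a permutation group, is isomorphic to the full symmetric group on some k-element subset of {1,...,n} (fixing the complement pointwise), with k > n/2. Then G = S_n. -/

import Mathlib

theorem transitive_contains_large_symmetric_eq_top (n k : ℕ)
    (G : Subgroup (Equiv.Perm (Fin n)))
    (htrans : ∀ i j : Fin n, ∃ σ ∈ G, σ i = j)
    (S : Finset (Fin n)) (hS : S.card = k) (hk : n < 2 * k)
    (hsym : ∀ σ : Equiv.Perm (Fin n), (∀ x ∉ S, σ x = x) → σ ∈ G) :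
    G = ⊤ := by
  have conj : ∀ σ ∈ G, ∀ x y, Equiv.swap x y ∈ G → Equiv.swap (σ x) (σ y) ∈ G := by
    intro σ hσ x y h
    rw [Equiv.swap_apply_apply]
    exact G.mul_mem (G.mul_mem hσ h) (G.inv_mem hσ)
  have tr : ∀ a b c, Equiv.swap a b ∈ G → Equiv.swap b c ∈ G → Equiv.swap a c ∈ G := by
    intro a b c h1 h2
    by_cases hab : a = b
    · subst hab; exact h2
    by_cases hac : a = c
    · subst hac; rw [Equiv.swap_self]; exact G.one_mem
    have := conj _ h2 a b h1
    rwa [Equiv.swap_apply_left, Equiv.swap_apply_of_ne_of_ne hab hac] at this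
  have inS : ∀ s ∈ S, ∀ t ∈ S, Equiv.swap s t ∈ G := by
    intro s hs t ht
    apply hsym
    intro x hx
    exact Equiv.swap_apply_of_ne_of_ne (fun h => hx (h ▸ hs)) (fun h => hx (h ▸ ht))
  have hne : S.Nonempty := by
    rw [← Finset.card_pos]; omega
  obtain ⟨s, hs⟩ := hne
  have key : ∀ j, Equiv.swap j s ∈ G := by
    intro j
    obtain ⟨σ, hσ, rfl⟩ := htrans s j
    have : ∃ t ∈ S, σ t ∈ S := by
      by_contra! hcon
      have hd : Disjoint S (S.map σ.toEmbedding) := by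
        rw [Finset.disjoint_right]
        intro y hy
        obtain ⟨t, ht, rfl⟩ := Finset.mem_map.1 hy
        exact hcon t ht
      have h1 := Finset.card_le_univ (S ∪ S.map σ.toEmbedding)
      rw [Finset.card_union_of_disjoint hd, Finset.card_map, Fintype.card_fin] at h1
      omega
    obtain ⟨t, ht, ht'⟩ := this
    exact tr _ (σ t) _ (conj σ hσ s t (inS s hs t ht)) (inS _ ht' s hs)
  rw [eq_top_iff, ← Equiv.Perm.closure_isSwap, Subgroup.closure_le]
  rintro _ ⟨x, y, -, rfl⟩
  refine tr x s y (key x) ?_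
  rw [Equiv.swap_comm]
  exact key y
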